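/- Let $K$ be a field of characteristic zero. An *almost Poisson algebra* $(A,[\cdot,\cdot],\cdot)$ is a $K$-vector space $A$ with a commutative associative bilinear product $\cdot$ and a skew-symmetric bilinear bracket $[\cdot,\cdot]$ such that $[x,y\cdot z]=[x,y]\cdot z+y\cdot[x,z]$ for all $x,y,z\in A$; a homomorphism of almost Poisson algebras is a linear map preserving product and bracket. An *$A$-module almost Poisson algebra* $(V,[\cdot,\cdot]_V,\cdot_V,\varrho,\mu)$ is an almost Poisson algebra $(V,[\cdot,\cdot]_V,\cdot_V)$ with linear maps $\varrho,\mu:A\to\mathrm{End}(V)$ such that, for all $x,y\in A$ and $a,b\in V$, $$\mu(x\cdot y)=\mu(x)\mu(y),\quad \varrho(x\cdot y)=\mu(y)\varrho(x)+\mu(x)\varrho(y),\quad \mu([x,y])=\varrho(x)\mu(y)-\mu(y)\varrho(x),$$ $$\mu(x)(a\cdot_V b)=(\mu(x)a)\cdot_V b,\quad \varrho(x)(a\cdot_V b)=(\varrho(x)a)\cdot_V b+a\cdot_V(\varrho(x)b),\quad [a,\mu(x)b]_V=-(\varrho(x)a)\cdot_V b+\mu(x)[a,b]_V.$$ For bilinear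 operations $\{\cdot,\cdot\},\Diamond,\ast,\rhd$ on $V$ put $$a\circ b=a\rhd b+b\rhd a+a\ast b,\qquad [\![a,b]\!]=a\Diamond b-b\Diamond a+\{a,b\}.$$ Then $(V,\{\cdot,\cdot\},\Diamond,\ast,\rhd)$ is an *almost tridendriform Poisson algebra* if $(V,\{\cdot,\cdot\},\ast)$ is an almost Poisson algebra, $(V,\ast,\rhd)$ is a commutative dendriform trialgebra, i.e. $\ast$ is commutative and associative and $$(a\circ b)\rhd c=a\rhd(b\rhd c),\qquad (a\rhd b)\ast c=a\rhd(b\ast c),$$ and, for all $a,b,c\in V$, $$a\Diamond(b\ast c)=(a\Diamond b)\ast c+b\ast(a\Diamond c),\qquad \{a,c\rhd b\}=c\rhd\{a,b\}-b\ast(c\Diamond a),$$ $$(b\circ c)\Diamond a=c\rhd(b\Diamond a)+b\rhd(c\Diamond a),\qquad [\![a,c]\!]\rhd b=a\Diamond(c\rhd b)-c\rhd(a\Diamond b).$$ **Theorem.** Let $(A,[\cdot,\cdot],\cdot)$ be an almost Poisson algebra, $(V,[\cdot,\cdot]_V,\cdot_V,\varrho,\mu)$ an $A$-module almost Poisson algebra,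 $\lambda\in K$, and $R:V\to A$ a weighted relative Rota-Baxter operator of weight $\lambda$, i.e. a linear map with $$R(a)\cdot R(b)=R\big(\mu(R(a))b+\mu(R(b))a+\lambda\,a\cdot_V b\big),\qquad [R(a),R(b)]=R\big(\varrho(R(a))b-\varrho(R(b))a+\lambda[a,b]_V\big)$$ for all $a,b\in V$. Define on $V$ the operations $\{a,b\}=\lambda[a,b]_V$, $a\Diamond b=\varrho(R(a))b$, $a\ast b=\lambda\,a\cdot_V b$ and $a\rhd b=\mu(R(a))b$. Then $(V,\{\cdot,\cdot\},\Diamond,\ast,\rhd)$ is an almost tridendriform Poisson algebra; moreover $V^C=(V,[\![\cdot,\cdot]\!],\circ)$ is an almost Poisson algebra, and $R$ is a homomorphism of almost Poisson algebras from $V^C$ to $(A,[\cdot,\cdot],\cdot)$. -/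

import Mathlib

section AlmostPoisson

variable {K A V : Type*} [Field K] [AddCommGroup A] [Module K A] [AddCommGroup V] [Module K V]

/-- The bilinear product `m` makes `A` a commutative associative (not necessarily unital)
algebra. -/
structure IsCommAssoc (m : A →ₗ[K] A →ₗ[K] A) : Prop where
  comm : ∀ x y, m x y = m y x
  assoc : ∀ x y z, m (m x y) z = m x (m y z)

/-- `(A, br, m)` is an almost Poisson algebra, with bracket `br` and product `m`. -/
structure IsAlmostPoisson (br m : A →ₗ[K] A →ₗ[K] A) : Prop where
  commAssoc : IsCommAssoc m
  skew : ∀ x y, br x y = -br y x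
  leibniz : ∀ x y z, br x (m y z) = m (br x y) z + m y (br x z)

/-- `(V, brV, mV, ϱ, μ)` is an `A`-module almost Poisson algebra over `(A, br, m)`. -/
structure IsModuleAlmostPoisson (br m : A →ₗ[K] A →ₗ[K] A) (brV mV : V →ₗ[K] V →ₗ[K] V)
    (ϱ μ : A →ₗ[K] Module.End K V) : Prop where
  almostPoisson : IsAlmostPoisson brV mV
  μ_mul : ∀ x y, μ (m x y) = μ x * μ y
  ϱ_mul : ∀ x y, ϱ (m x y) = μ y * ϱ x + μ x * ϱ y
  μ_br : ∀ x y, μ (br x y) = ϱ x * μ y - μ y * ϱ x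
  μ_mulV : ∀ x a b, μ x (mV a b) = mV (μ x a) b
  ϱ_mulV : ∀ x a b, ϱ x (mV a b) = mV (ϱ x a) b + mV a (ϱ x b)
  brV_μ : ∀ x a b, brV a (μ x b) = -mV (ϱ x a) b + μ x (brV a b)

/-- The associated product `a ▷ b + b ▷ a + a ∗ b`. -/
def assocMul (m tr : V →ₗ[K] V →ₗ[K] V) : V →ₗ[K] V →ₗ[K] V :=
  tr + tr.flip + m

/-- The associated bracket `a ◇ b - b ◇ a + {a, b}`. -/
def assocBr (br dia : V →ₗ[K] V →ₗ[K] V) : V →ₗ[K] V →ₗ[K] V :=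
  dia - dia.flip + br

/-- `(V, m, tr)` is a commutative dendriform trialgebra, with `m` the operation `∗` and `tr` the
operation `▷`. The first mixed axiom involves the associated product, not `∗`. -/
structure IsCommDendriformTrialgebra (m tr : V →ₗ[K] V →ₗ[K] V) : Prop where
  commAssoc : IsCommAssoc m
  assocMul_tr : ∀ a b c, tr (assocMul m tr a b) c = tr a (tr b c)
  tr_mul : ∀ a b c, m (tr a b) c = tr a (m b c)

/-- `(V, br, dia, m, tr)` is an almost tridendriform Poisson algebra, with `br` the bracket
`{·,·}`, and `dia`, `m`, `tr` the operations `◇`, `∗`, `▷`. -/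
structure IsAlmostTridendriformPoisson (br dia m tr : V →ₗ[K] V →ₗ[K] V) : Prop where
  almostPoisson : IsAlmostPoisson br m
  trialgebra : IsCommDendriformTrialgebra m tr
  dia_mul : ∀ a b c, dia a (m b c) = m (dia a b) c + m b (dia a c)
  br_tr : ∀ a b c, br a (tr c b) = tr c (br a b) - m b (dia c a)
  assocMul_dia : ∀ a b c, dia (assocMul m tr b c) a = tr c (dia b a) + tr b (dia c a)
  assocBr_tr : ∀ a b c, tr (assocBr br dia a c) b = dia a (tr c b) - tr c (dia a b)

/-- `R : V → A` is a weighted relative Rota-Baxter operator of weight `lam` on `(A, br, m)` with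
respect to `(V, brV, mV, ϱ, μ)`. -/
structure IsRelRotaBaxter (br m : A →ₗ[K] A →ₗ[K] A) (brV mV : V →ₗ[K] V →ₗ[K] V)
    (ϱ μ : A →ₗ[K] Module.End K V) (lam : K) (R : V →ₗ[K] A) : Prop where
  mul : ∀ a b, m (R a) (R b) = R (μ (R a) b + μ (R b) a + lam • mV a b)
  br : ∀ a b, br (R a) (R b) = R (ϱ (R a) b - ϱ (R b) a + lam • brV a b)

/-- The linear map `f` is a homomorphism of almost Poisson algebras from `(V, brV, mV)` to
`(A, br, m)`; that both sides are almost Poisson algebras is part of the assertion. -/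
structure IsAlmostPoissonHom (brV mV : V →ₗ[K] V →ₗ[K] V) (br m : A →ₗ[K] A →ₗ[K] A)
    (f : V →ₗ[K] A) : Prop where
  source : IsAlmostPoisson brV mV
  target : IsAlmostPoisson br m
  map_mul : ∀ a b, f (mV a b) = m (f a) (f b)
  map_br : ∀ a b, f (brV a b) = br (f a) (f b)

end AlmostPoisson

section AssociatedOperations

variable {K V : Type*} [Field K] [AddCommGroup V] [Module K V]

theorem assocMul_apply (m tr : V →ₗ[K] V →ₗ[K] V) (a b : V) :
    assocMul m tr a b = tr a b + tr b a + m a b := rfl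

theorem assocBr_apply (br dia : V →ₗ[K] V →ₗ[K] V) (a b : V) :
    assocBr br dia a b = dia a b - dia b a + br a b := rfl

/-- The associated product of a commutative dendriform trialgebra is commutative and
associative. -/
theorem IsCommDendriformTrialgebra.isCommAssoc_assocMul {m tr : V →ₗ[K] V →ₗ[K] V}
    (h : IsCommDendriformTrialgebra m tr) : IsCommAssoc (assocMul m tr) := by
  have hcomm : ∀ a b, assocMul m tr a b = assocMul m tr b a := fun a b => by
    rw [assocMul_apply, assocMul_apply, h.commAssoc.comm a b, add_comm (tr a b)]
  have htr : ∀ a b c, tr a (tr b c) = tr b (tr a c) := fun a b c => by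
    rw [← h.assocMul_tr, hcomm, h.assocMul_tr]
  refine ⟨hcomm, fun a b c => ?_⟩
  rw [assocMul_apply m tr (assocMul m tr a b) c, assocMul_apply m tr a (assocMul m tr b c),
    h.assocMul_tr, h.assocMul_tr, assocMul_apply m tr a b, assocMul_apply m tr b c]
  simp only [map_add, LinearMap.add_apply]
  rw [h.tr_mul a b c, h.tr_mul b a c, h.commAssoc.comm a (tr b c), h.commAssoc.comm a (tr c b),
    h.tr_mul b c a, h.tr_mul c b a, h.commAssoc.assoc a b c, h.commAssoc.comm c a,
    h.commAssoc.comm b a, htr c a b, htr c b a]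
  abel

/-- The associated operations of an almost tridendriform Poisson algebra form an almost Poisson
algebra. -/
theorem IsAlmostTridendriformPoisson.isAlmostPoisson_assoc {br dia m tr : V →ₗ[K] V →ₗ[K] V}
    (h : IsAlmostTridendriformPoisson br dia m tr) :
    IsAlmostPoisson (assocBr br dia) (assocMul m tr) := by
  refine ⟨h.trialgebra.isCommAssoc_assocMul, fun a b => ?_, fun a b c => ?_⟩
  · rw [assocBr_apply, assocBr_apply, h.almostPoisson.skew a b]
    abel
  · rw [assocBr_apply br dia a (assocMul m tr b c), h.assocMul_dia,
      assocMul_apply m tr (assocBr br dia a b) c, assocMul_apply m tr b (assocBr br dia a c),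
      h.assocBr_tr, h.assocBr_tr, assocMul_apply, assocBr_apply, assocBr_apply]
    simp only [map_add, map_sub, LinearMap.add_apply, LinearMap.sub_apply]
    rw [h.dia_mul, h.br_tr, h.br_tr, h.almostPoisson.leibniz,
      h.almostPoisson.commAssoc.comm c (dia b a)]
    abel

end AssociatedOperations

section RotaBaxter

variable {K A V : Type*} [Field K] [AddCommGroup A] [Module K A] [AddCommGroup V] [Module K V]

/-- Rescaling both operations of an almost Poisson algebra by the same scalar gives an almost
Poisson algebra. -/
theorem IsAlmostPoisson.smul {br m : A →ₗ[K] A →ₗ[K] A} (h : IsAlmostPoisson br m) (lam : K) :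
    IsAlmostPoisson (lam • br) (lam • m) where
  commAssoc :=
    { comm := fun x y => by simp only [LinearMap.smul_apply, h.commAssoc.comm x y]
      assoc := fun x y z => by
        simp only [LinearMap.smul_apply, map_smul, h.commAssoc.assoc x y z] }
  skew x y := by simp only [LinearMap.smul_apply, h.skew x y, smul_neg]
  leibniz x y z := by
    simp only [LinearMap.smul_apply, map_smul, h.leibniz x y z, smul_add]

variable {br m : A →ₗ[K] A →ₗ[K] A} {brV mV : V →ₗ[K] V →ₗ[K] V}
  {ϱ μ : A →ₗ[K] Module.End K V} {lam : K} {R : V →ₗ[K] A}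

theorem IsRelRotaBaxter.map_assocMul (hR : IsRelRotaBaxter br m brV mV ϱ μ lam R) (a b : V) :
    R (assocMul (lam • mV) (μ ∘ₗ R) a b) = m (R a) (R b) :=
  (hR.mul a b).symm

theorem IsRelRotaBaxter.map_assocBr (hR : IsRelRotaBaxter br m brV mV ϱ μ lam R) (a b : V) :
    R (assocBr (lam • brV) (ϱ ∘ₗ R) a b) = br (R a) (R b) :=
  (hR.br a b).symm

/-- A weighted relative Rota-Baxter operator induces an almost tridendriform Poisson algebra. -/
theorem IsRelRotaBaxter.isAlmostTridendriformPoisson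
    (hV : IsModuleAlmostPoisson br m brV mV ϱ μ) (hR : IsRelRotaBaxter br m brV mV ϱ μ lam R) :
    IsAlmostTridendriformPoisson (lam • brV) (ϱ ∘ₗ R) (lam • mV) (μ ∘ₗ R) where
  almostPoisson := hV.almostPoisson.smul lam
  trialgebra :=
    { commAssoc := (hV.almostPoisson.smul lam).commAssoc
      assocMul_tr := fun a b c => by
        rw [LinearMap.comp_apply, hR.map_assocMul, hV.μ_mul]
        rfl
      tr_mul := fun a b c => by
        simp only [LinearMap.comp_apply, LinearMap.smul_apply, map_smul, hV.μ_mulV] }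
  dia_mul a b c := by
    simp only [LinearMap.comp_apply, LinearMap.smul_apply, map_smul, hV.ϱ_mulV, smul_add]
  br_tr a b c := by
    simp only [LinearMap.comp_apply, LinearMap.smul_apply, map_smul, hV.brV_μ, smul_add, smul_neg]
    rw [hV.almostPoisson.commAssoc.comm b]
    abel
  assocMul_dia a b c := by
    rw [LinearMap.comp_apply, hR.map_assocMul, hV.ϱ_mul]
    rfl
  assocBr_tr a b c := by
    rw [LinearMap.comp_apply, hR.map_assocBr, hV.μ_br]
    rfl

end RotaBaxter

/-- With `{a, b} = lam • [a, b]_V`, `a ◇ b = ϱ (R a) b`, `a ∗ b = lam • (a ·_V b)` and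
`a ▷ b = μ (R a) b`, the space `V` is an almost tridendriform Poisson algebra, and `R` is a
homomorphism of almost Poisson algebras from the associated almost Poisson algebra to `A`. -/
theorem stmt11 {K A V : Type*} [Field K] [CharZero K] [AddCommGroup A] [Module K A]
    [AddCommGroup V] [Module K V]
    (br m : A →ₗ[K] A →ₗ[K] A) (brV mV : V →ₗ[K] V →ₗ[K] V)
    (ϱ μ : A →ₗ[K] Module.End K V) (lam : K) (R : V →ₗ[K] A)
    (hA : IsAlmostPoisson br m) (hV : IsModuleAlmostPoisson br m brV mV ϱ μ)
    (hR : IsRelRotaBaxter br m brV mV ϱ μ lam R) :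
    IsAlmostTridendriformPoisson (lam • brV) (ϱ ∘ₗ R) (lam • mV) (μ ∘ₗ R) ∧
      IsAlmostPoissonHom (assocBr (lam • brV) (ϱ ∘ₗ R)) (assocMul (lam • mV) (μ ∘ₗ R)) br m R := by
  have h := hR.isAlmostTridendriformPoisson hV
  exact ⟨h, h.isAlmostPoisson_assoc, hA, hR.map_assocMul, hR.map_assocBr⟩
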